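/- Let θ ∈ (0, π) be fixed. Then for all x, y ∈ S_θ, the inequality p_{S_θ}(x,y)/(√2·cos(θ/4)) ≤ s_{S_θ}(x,y) holds. -/

import Mathlib

open Set Metric Complex

/-- The open sector of angle `θ`: points with polar angle strictly between `0` and `θ`. -/
noncomputable def sector (θ : ℝ) : Set ℂ :=
  {z : ℂ | ∃ r φ : ℝ, 0 < r ∧ 0 < φ ∧ φ < θ ∧ z = r * Complex.exp (φ * Complex.I)}

/-- Distance from `x` to the boundary of `G`. -/
noncomputable def distBd (G : Set ℂ) (x : ℂ) : ℝ :=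
  Metric.infDist x (frontier G)

/-- The triangular ratio metric `s_G`. -/
noncomputable def triRatio (G : Set ℂ) (x y : ℂ) : ℝ :=
  dist x y / sInf ((fun z => dist x z + dist z y) '' frontier G)

/-- The `j*`-metric. -/
noncomputable def jStar (G : Set ℂ) (x y : ℂ) : ℝ :=
  dist x y / (dist x y + 2 * min (distBd G x) (distBd G y))

/-- The point pair function `p_G`. -/
noncomputable def pointPair (G : Set ℂ) (x y : ℂ) : ℝ :=
  dist x y / Real.sqrt (dist x y ^ 2 + 4 * distBd G x * distBd G y)

lemma mem_sector_iff {θ : ℝ} (hθ : 0 < θ ∧ θ < Real.pi) (z : ℂ) :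
    z ∈ sector θ ↔ 0 < z.im ∧ 0 < Real.sin θ * z.re - Real.cos θ * z.im := by
  constructor
  · rintro ⟨r, φ, hr, h0, h1, rfl⟩
    have e1 : (↑r * exp (↑φ * I)).im = r * Real.sin φ := by simp [exp_ofReal_mul_I_im]
    have e2 : (↑r * exp (↑φ * I)).re = r * Real.cos φ := by simp [exp_ofReal_mul_I_re]
    rw [e1, e2]
    refine ⟨mul_pos hr (Real.sin_pos_of_pos_of_lt_pi h0 (by linarith)), ?_⟩
    have := mul_pos hr (Real.sin_pos_of_pos_of_lt_pi (x := θ - φ) (by linarith) (by linarith))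
    rw [Real.sin_sub] at this
    linarith
  · rintro ⟨h1, h2⟩
    have hz : z ≠ 0 := by rintro rfl; simp at h1
    have hr : 0 < ‖z‖ := norm_pos_iff.mpr hz
    have e1 := norm_mul_sin_arg z
    have e2 := norm_mul_cos_arg z
    have hs : 0 < Real.sin z.arg := by
      rw [← e1] at h1
      exact pos_of_mul_pos_right h1 hr.le
    have ha : 0 < z.arg := by
      by_contra! h
      exact absurd (Real.sin_nonpos_of_nonpos_of_neg_pi_le h (neg_pi_lt_arg z).le) (not_le.mpr hs)
    refine ⟨‖z‖, z.arg, hr, ha, ?_, (norm_mul_exp_arg_mul_I z).symm⟩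
    rw [← e1, ← e2] at h2
    by_contra! h
    have := Real.sin_nonpos_of_nonpos_of_neg_pi_le (x := θ - z.arg) (by linarith)
      (by linarith [arg_le_pi z])
    rw [Real.sin_sub] at this
    nlinarith

lemma isOpen_sector {θ : ℝ} (hθ : 0 < θ ∧ θ < Real.pi) : IsOpen (sector θ) := by
  have : sector θ = {z : ℂ | 0 < z.im} ∩ {z : ℂ | 0 < Real.sin θ * z.re - Real.cos θ * z.im} :=
    Set.ext fun z => mem_sector_iff hθ z
  rw [this]
  exact (isOpen_lt (by fun_prop) (by fun_prop)).inter (isOpen_lt (by fun_prop) (by fun_prop))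

lemma im_nonpos_or_of_mem_frontier_sector {θ : ℝ} (hθ : 0 < θ ∧ θ < Real.pi) {z : ℂ}
    (hz : z ∈ frontier (sector θ)) :
    z.im ≤ 0 ∨ Real.sin θ * z.re - Real.cos θ * z.im ≤ 0 := by
  rw [(isOpen_sector hθ).frontier_eq] at hz
  have := hz.2
  rw [mem_sector_iff hθ] at this
  by_contra! h
  exact this h

lemma mem_frontier_sector {θ : ℝ} (hθ : 0 < θ ∧ θ < Real.pi) {z : ℂ}
    (h1 : 0 ≤ z.im) (h2 : 0 ≤ Real.sin θ * z.re - Real.cos θ * z.im)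
    (h : z.im = 0 ∨ Real.sin θ * z.re - Real.cos θ * z.im = 0) :
    z ∈ frontier (sector θ) := by
  rw [(isOpen_sector hθ).frontier_eq]
  constructor
  · have hs : 0 < Real.sin (θ / 2) :=
      Real.sin_pos_of_pos_of_lt_pi (by linarith) (by linarith)
    have hd : Real.sin θ * Real.cos (θ / 2) - Real.cos θ * Real.sin (θ / 2)
        = Real.sin (θ / 2) := by
      rw [← Real.sin_sub]; congr 1; ring
    have hlim : Filter.Tendsto (fun ε : ℝ => z + ε * exp ((θ / 2 : ℝ) * I))
        (nhdsWithin 0 (Ioi 0)) (nhds z) := by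
      have : Continuous (fun ε : ℝ => z + ε * exp ((θ / 2 : ℝ) * I)) := by fun_prop
      have := this.tendsto 0
      simp only [ofReal_zero, zero_mul, add_zero] at this
      exact this.mono_left nhdsWithin_le_nhds
    refine mem_closure_of_tendsto hlim ?_
    filter_upwards [self_mem_nhdsWithin] with ε hε
    have hε : 0 < ε := hε
    rw [mem_sector_iff hθ]
    have e1 : (z + ε * exp ((θ / 2 : ℝ) * I)).im = z.im + ε * Real.sin (θ / 2) := by
      rw [add_im, im_ofReal_mul, exp_ofReal_mul_I_im]
    have e2 : (z + ε * exp ((θ / 2 : ℝ) * I)).re = z.re + ε * Real.cos (θ / 2) := by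
      rw [add_re, re_ofReal_mul, exp_ofReal_mul_I_re]
    rw [e1, e2]
    have := mul_pos hε hs
    refine ⟨by linarith, ?_⟩
    have : Real.sin θ * (z.re + ε * Real.cos (θ / 2)) - Real.cos θ * (z.im + ε * Real.sin (θ / 2))
      = Real.sin θ * z.re - Real.cos θ * z.im + ε * Real.sin (θ / 2) := by
      linear_combination ε * hd
    linarith
  · rw [mem_sector_iff hθ]
    rintro ⟨h3, h4⟩
    rcases h with h | h <;> linarith

lemma ofReal_mem_frontier_sector {θ : ℝ} (hθ : 0 < θ ∧ θ < Real.pi) {t : ℝ} (ht : 0 ≤ t) :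
    (t : ℂ) * exp ((0 : ℝ) * I) ∈ frontier (sector θ) := by
  have hs := Real.sin_pos_of_pos_of_lt_pi hθ.1 hθ.2
  apply mem_frontier_sector hθ <;> simp
  positivity

lemma ofReal_mul_exp_mem_frontier_sector {θ : ℝ} (hθ : 0 < θ ∧ θ < Real.pi) {t : ℝ}
    (ht : 0 ≤ t) : (t : ℂ) * exp (θ * I) ∈ frontier (sector θ) := by
  have hs := Real.sin_pos_of_pos_of_lt_pi hθ.1 hθ.2
  have e1 : (↑t * exp (↑θ * I)).im = t * Real.sin θ := by
    rw [im_ofReal_mul, exp_ofReal_mul_I_im]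
  have e2 : (↑t * exp (↑θ * I)).re = t * Real.cos θ := by
    rw [re_ofReal_mul, exp_ofReal_mul_I_re]
  have e3 : Real.sin θ * (t * Real.cos θ) - Real.cos θ * (t * Real.sin θ) = 0 := by ring
  apply mem_frontier_sector hθ <;> rw [e1]
  · positivity
  · rw [e2, e3]
  · rw [e2, e3]; simp

lemma dist_polar (r s a b : ℝ) :
    dist ((r : ℂ) * exp (a * I)) (s * exp (b * I))
      = Real.sqrt (r ^ 2 + s ^ 2 - 2 * r * s * Real.cos (a - b)) := by
  rw [Complex.dist_eq_re_im]
  simp only [re_ofReal_mul, im_ofReal_mul, exp_ofReal_mul_I_re, exp_ofReal_mul_I_im]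
  congr 1
  rw [Real.cos_sub]
  linear_combination r ^ 2 * Real.sin_sq_add_cos_sq a + s ^ 2 * Real.sin_sq_add_cos_sq b

lemma le_distBd_sector {θ r φ : ℝ} (hθ : 0 < θ ∧ θ < Real.pi) :
    min (r * Real.sin φ) (r * Real.sin (θ - φ)) ≤ distBd (sector θ) (r * exp (φ * I)) := by
  refine (le_infDist ⟨_, ofReal_mem_frontier_sector hθ le_rfl⟩).mpr fun z hz => ?_
  have e1 : (↑r * exp (↑φ * I)).im = r * Real.sin φ := by
    rw [im_ofReal_mul, exp_ofReal_mul_I_im]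
  have e2 : (↑r * exp (↑φ * I)).re = r * Real.cos φ := by
    rw [re_ofReal_mul, exp_ofReal_mul_I_re]
  rcases im_nonpos_or_of_mem_frontier_sector hθ hz with h | h
  · refine (min_le_left _ _).trans ?_
    have := (le_abs_self _).trans (abs_im_le_norm (↑r * exp (↑φ * I) - z))
    rw [sub_im, e1] at this
    rw [Complex.dist_eq]
    linarith
  · refine (min_le_right _ _).trans ?_
    rw [Complex.dist_eq_re_im, e1, e2, Real.sin_sub]
    refine le_trans (b := Real.sin θ * (r * Real.cos φ - z.re)
      - Real.cos θ * (r * Real.sin φ - z.im)) (by linarith) (Real.le_sqrt_of_sq_le ?_)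
    nlinarith [sq_nonneg (Real.cos θ * (r * Real.cos φ - z.re)
      + Real.sin θ * (r * Real.sin φ - z.im)), Real.sin_sq_add_cos_sq θ]

lemma exists_reflection_point {r s a b : ℝ} (hr : 0 < r) (hs : 0 < s) (ha : 0 < a) (hb : 0 < b)
    (hab : a + b ≤ Real.pi) :
    ∃ t : ℝ, 0 ≤ t ∧
      Real.sqrt (r ^ 2 + t ^ 2 - 2 * r * t * Real.cos a)
        + Real.sqrt (t ^ 2 + s ^ 2 - 2 * t * s * Real.cos b)
        = Real.sqrt (r ^ 2 + s ^ 2 - 2 * r * s * Real.cos (a + b)) := by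
  have h1 : 0 < r * Real.sin a :=
    mul_pos hr (Real.sin_pos_of_pos_of_lt_pi ha (by linarith))
  have h2 : 0 < s * Real.sin b :=
    mul_pos hs (Real.sin_pos_of_pos_of_lt_pi hb (by linarith))
  have h3 : 0 ≤ Real.sin (a + b) := Real.sin_nonneg_of_nonneg_of_le_pi (by linarith) hab
  set d := r * Real.sin a + s * Real.sin b with hd
  have hd0 : 0 < d := by linarith
  set t := r * s * Real.sin (a + b) / d with ht
  refine ⟨t, by positivity, ?_⟩
  have e1 := dist_polar r t a 0
  have e2 := dist_polar t s 0 (-b)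
  have e3 := dist_polar r s a (-b)
  rw [sub_zero] at e1
  rw [sub_neg_eq_add, zero_add] at e2
  rw [sub_neg_eq_add] at e3
  rw [← e1, ← e2, ← e3]
  refine dist_add_dist_of_mem_segment
    ⟨s * Real.sin b / d, r * Real.sin a / d, by positivity, by positivity, ?_, ?_⟩
  · rw [← add_div, add_comm]; exact div_self hd0.ne'
  · apply Complex.ext
    · simp only [add_re, real_smul, re_ofReal_mul, exp_ofReal_mul_I_re, ht, Real.sin_add,
        Real.cos_neg, Real.cos_zero]
      field_simp
      ring
    · simp only [add_im, real_smul, im_ofReal_mul, exp_ofReal_mul_I_im, ht, Real.sin_neg,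
        Real.sin_zero]
      field_simp
      ring

lemma cos_bound {θ φ ψ : ℝ} (hθ : 0 < θ ∧ θ < Real.pi) (hφ : 0 < φ)
    (hψ : θ / 2 ≤ ψ) (h : φ + ψ ≤ θ) :
    0 ≤ Real.cos (θ / 2) + Real.cos (φ + ψ) + (1 + Real.cos (θ / 2)) *
      (2 * Real.sin φ * Real.sin (θ - ψ) - Real.cos (φ - ψ)) := by
  obtain ⟨x, hx⟩ : ∃ x, x = θ / 4 := ⟨_, rfl⟩
  obtain ⟨y, hy⟩ : ∃ y, y = (θ - ψ - φ) / 2 := ⟨_, rfl⟩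
  obtain ⟨v, hv⟩ : ∃ v, v = φ - ψ + θ / 2 := ⟨_, rfl⟩
  have e1 : θ / 2 = 2 * x := by linarith
  have e2 : φ + ψ = 2 * (2 * x) - 2 * y := by linarith
  have e3 : φ - ψ = v - 2 * x := by linarith
  have e4 : φ = (v + 2 * x) / 2 - y := by linarith
  have e5 : θ - ψ = (v + 2 * x) / 2 + y := by linarith
  have key : 2 * Real.sin φ * Real.sin (θ - ψ) = Real.cos (2 * y) - Real.cos (v + 2 * x) := by
    rw [Real.two_mul_sin_mul_sin, e4, e5, ← Real.cos_neg (2 * y)]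
    congr 2 <;> ring
  rw [key, e2, e1, e3, Real.cos_add, Real.cos_sub v, Real.cos_sub, Real.cos_two_mul (2 * x),
    Real.sin_two_mul (2 * x)]
  have hsx : 0 ≤ Real.sin x := Real.sin_nonneg_of_nonneg_of_le_pi (by linarith) (by linarith)
  have hsy : 0 ≤ Real.sin y := Real.sin_nonneg_of_nonneg_of_le_pi (by linarith) (by linarith)
  have hcy : Real.cos x ≤ Real.cos y :=
    Real.cos_le_cos_of_nonneg_of_le_pi (by linarith) (by linarith) (by linarith)
  have hsyx : Real.sin y ≤ Real.sin x :=
    Real.sin_le_sin_of_le_of_le_pi_div_two (by linarith) (by linarith) (by linarith)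
  have hc : 0 < Real.cos (2 * x) := Real.cos_pos_of_mem_Ioo ⟨by linarith, by linarith⟩
  have hcx : 0 < Real.cos x := Real.cos_pos_of_mem_Ioo ⟨by linarith, by linarith⟩
  have hv1 := Real.cos_le_one v
  have hc2 : Real.cos (2 * x) = 2 * Real.cos x ^ 2 - 1 := Real.cos_two_mul x
  have hs2 : Real.sin (2 * x) = 2 * Real.sin x * Real.cos x := Real.sin_two_mul x
  have main : (2 * Real.cos (2 * x) + 1) * Real.sin y ≤ 2 * Real.sin (2 * x) * Real.cos y := by
    calc (2 * Real.cos (2 * x) + 1) * Real.sin y ≤ (2 * Real.cos (2 * x) + 1) * Real.sin x := by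
          gcongr
      _ ≤ 2 * Real.sin (2 * x) * Real.cos x := by rw [hc2, hs2]; nlinarith
      _ ≤ _ := by
          rw [hs2]; gcongr
  have hA : 0 ≤ Real.cos (2 * x) * (1 + Real.cos (2 * x)) * (1 - Real.cos v) :=
    mul_nonneg (by positivity) (by linarith)
  have hB := mul_nonneg (mul_nonneg hc.le hsy) (sub_nonneg.mpr main)
  have hy1 : Real.cos (2 * y) = 1 - 2 * Real.sin y ^ 2 := by
    rw [Real.cos_two_mul, Real.cos_sq']; ring
  rw [hy1, Real.sin_two_mul y]
  nlinarith

lemma sin_le_sin_sub {θ φ : ℝ} (hθ : 0 < θ ∧ θ < Real.pi) (hφ : 0 < φ) (h : φ ≤ θ / 2) :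
    Real.sin φ ≤ Real.sin (θ - φ) := by
  have e := Real.sin_sub_sin (θ - φ) φ
  have h1 : 0 ≤ Real.sin ((θ - φ - φ) / 2) :=
    Real.sin_nonneg_of_nonneg_of_le_pi (by linarith) (by linarith)
  have h2 : 0 ≤ Real.cos ((θ - φ + φ) / 2) :=
    Real.cos_nonneg_of_mem_Icc ⟨by linarith, by linarith⟩
  nlinarith [mul_nonneg h1 h2]

lemma reflected_sq_le_of_far {θ r s φ ψ : ℝ} (hθ : 0 < θ ∧ θ < Real.pi) (hr : 0 < r)
    (hs : 0 < s) (hφ : 0 < φ) (hψ : θ / 2 ≤ ψ) (h : φ + ψ ≤ θ) :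
    r ^ 2 + s ^ 2 - 2 * r * s * Real.cos (φ + ψ) ≤ (1 + Real.cos (θ / 2)) *
      (r ^ 2 + s ^ 2 - 2 * r * s * Real.cos (φ - ψ)
        + 4 * min (r * Real.sin φ) (r * Real.sin (θ - φ))
          * min (s * Real.sin ψ) (s * Real.sin (θ - ψ))) := by
  have h1 := sin_le_sin_sub hθ hφ (by linarith)
  have h2 := sin_le_sin_sub hθ (φ := θ - ψ) (by linarith) (by linarith)
  rw [sub_sub_cancel] at h2
  rw [min_eq_left (by gcongr), min_eq_right (by gcongr)]
  have hc : 0 ≤ Real.cos (θ / 2) := Real.cos_nonneg_of_mem_Icc ⟨by linarith, by linarith⟩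
  have hB := mul_nonneg (mul_pos hr hs).le (cos_bound hθ hφ hψ h)
  nlinarith [mul_nonneg hc (sq_nonneg (r - s))]

lemma reflected_sq_le {θ r s φ ψ : ℝ} (hθ : 0 < θ ∧ θ < Real.pi) (hr : 0 < r)
    (hs : 0 < s) (hφ : 0 < φ) (hψ : 0 < ψ) (h : φ + ψ ≤ θ) :
    r ^ 2 + s ^ 2 - 2 * r * s * Real.cos (φ + ψ) ≤ (1 + Real.cos (θ / 2)) *
      (r ^ 2 + s ^ 2 - 2 * r * s * Real.cos (φ - ψ)
        + 4 * min (r * Real.sin φ) (r * Real.sin (θ - φ))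
          * min (s * Real.sin ψ) (s * Real.sin (θ - ψ))) := by
  rcases le_total (θ / 2) ψ with h1 | h1
  · exact reflected_sq_le_of_far hθ hr hs hφ h1 h
  rcases le_total (θ / 2) φ with h2 | h2
  · have := reflected_sq_le_of_far hθ hs hr hψ h2 (by linarith)
    rw [← Real.cos_neg (ψ - φ), neg_sub, add_comm ψ φ] at this
    linarith
  have h3 := sin_le_sin_sub hθ hφ h2
  have h4 := sin_le_sin_sub hθ hψ h1
  rw [min_eq_left (by gcongr), min_eq_left (by gcongr)]
  have hc : 0 ≤ Real.cos (θ / 2) := Real.cos_nonneg_of_mem_Icc ⟨by linarith, by linarith⟩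
  have e : r ^ 2 + s ^ 2 - 2 * r * s * Real.cos (φ - ψ) + 4 * (r * Real.sin φ) * (s * Real.sin ψ)
      = r ^ 2 + s ^ 2 - 2 * r * s * Real.cos (φ + ψ) := by
    rw [Real.cos_add, Real.cos_sub]; ring
  rw [e]
  refine le_mul_of_one_le_left ?_ (by linarith)
  nlinarith [mul_nonneg (mul_pos hr hs).le (sub_nonneg.mpr (Real.cos_le_one (φ + ψ))),
    sq_nonneg (r - s)]

lemma exists_frontier_sector_dist_add_dist_sq_le {θ : ℝ} (hθ : 0 < θ ∧ θ < Real.pi) {x y : ℂ}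
    (hx : x ∈ sector θ) (hy : y ∈ sector θ) :
    ∃ z ∈ frontier (sector θ), dist x z + dist z y ≤
      Real.sqrt ((1 + Real.cos (θ / 2)) *
        (dist x y ^ 2 + 4 * distBd (sector θ) x * distBd (sector θ) y)) := by
  obtain ⟨r, φ, hr, hφ, hφθ, rfl⟩ := hx
  obtain ⟨s, ψ, hs, hψ, hψθ, rfl⟩ := hy
  have hc : 0 ≤ Real.cos (θ / 2) := Real.cos_nonneg_of_mem_Icc ⟨by linarith, by linarith⟩
  have hsin : ∀ {ρ α : ℝ}, 0 < ρ → 0 < α → α < θ →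
      0 ≤ min (ρ * Real.sin α) (ρ * Real.sin (θ - α)) := fun {ρ α} h0 h1 h2 =>
    le_min (mul_nonneg h0.le (Real.sin_nonneg_of_nonneg_of_le_pi h1.le (by linarith)))
      (mul_nonneg h0.le (Real.sin_nonneg_of_nonneg_of_le_pi (by linarith) (by linarith)))
  have hD := mul_le_mul (le_distBd_sector (r := r) (φ := φ) hθ)
    (le_distBd_sector (r := s) (φ := ψ) hθ) (hsin hs hψ hψθ) infDist_nonneg
  have hdist : dist ((r : ℂ) * exp (φ * I)) (s * exp (ψ * I)) ^ 2
      = r ^ 2 + s ^ 2 - 2 * r * s * Real.cos (φ - ψ) := by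
    rw [dist_polar, Real.sq_sqrt]
    nlinarith [mul_nonneg (mul_pos hr hs).le (sub_nonneg.mpr (Real.cos_le_one (φ - ψ))),
      sq_nonneg (r - s)]
  rw [hdist]
  rcases le_total (φ + ψ) θ with h | h
  · obtain ⟨t, ht, e⟩ := exists_reflection_point hr hs hφ hψ (by linarith)
    refine ⟨_, ofReal_mem_frontier_sector hθ ht, ?_⟩
    rw [dist_polar, dist_polar, sub_zero, zero_sub, Real.cos_neg, e]
    refine Real.sqrt_le_sqrt ((reflected_sq_le hθ hr hs hφ hψ h).trans ?_)
    gcongr ?_ * ?_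
    linarith
  · obtain ⟨t, ht, e⟩ := exists_reflection_point hr hs (a := θ - φ) (b := θ - ψ)
      (by linarith) (by linarith) (by linarith)
    refine ⟨_, ofReal_mul_exp_mem_frontier_sector hθ ht, ?_⟩
    rw [dist_polar, dist_polar, ← Real.cos_neg (φ - θ), neg_sub, e]
    refine Real.sqrt_le_sqrt ((reflected_sq_le hθ hr hs (φ := θ - φ) (ψ := θ - ψ)
      (by linarith) (by linarith) (by linarith)).trans ?_)
    rw [sub_sub_cancel, sub_sub_cancel, min_comm, min_comm (s * _), sub_sub_sub_cancel_left,
      ← Real.cos_neg (ψ - φ), neg_sub]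
    gcongr ?_ * ?_
    linarith

theorem stmt_5 (θ : ℝ) (hθ : 0 < θ ∧ θ < Real.pi) :
    ∀ x ∈ sector θ, ∀ y ∈ sector θ,
      pointPair (sector θ) x y / (Real.sqrt 2 * Real.cos (θ / 4)) ≤
        triRatio (sector θ) x y := by
  intro x hx y hy
  rcases eq_or_ne x y with rfl | hne
  · simp [pointPair, triRatio]
  obtain ⟨z, hz, hle⟩ := exists_frontier_sector_dist_add_dist_sq_le hθ hx hy
  have hd : 0 < dist x y := dist_pos.mpr hne
  have hlow : ∀ b ∈ (fun z => dist x z + dist z y) '' frontier (sector θ), dist x y ≤ b := by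
    rintro _ ⟨w, -, rfl⟩
    exact dist_triangle _ _ _
  have hI : dist x y ≤ sInf ((fun z => dist x z + dist z y) '' frontier (sector θ)) :=
    le_csInf ⟨_, z, hz, rfl⟩ hlow
  have hI' : sInf ((fun z => dist x z + dist z y) '' frontier (sector θ))
      ≤ dist x z + dist z y := csInf_le ⟨_, hlow⟩ ⟨z, hz, rfl⟩
  have hK : Real.sqrt (1 + Real.cos (θ / 2)) = Real.sqrt 2 * Real.cos (θ / 4) := by
    have hc : 0 ≤ Real.cos (θ / 4) := Real.cos_nonneg_of_mem_Icc ⟨by linarith, by linarith⟩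
    have e : θ / 2 = 2 * (θ / 4) := by ring
    rw [e, Real.cos_two_mul, add_sub_cancel, Real.sqrt_mul zero_le_two, Real.sqrt_sq hc]
  have hc2 : 0 ≤ Real.cos (θ / 2) := Real.cos_nonneg_of_mem_Icc ⟨by linarith, by linarith⟩
  rw [Real.sqrt_mul (by linarith), hK] at hle
  rw [pointPair, triRatio, div_div]
  refine div_le_div_of_nonneg_left hd.le (hd.trans_le hI) ?_
  rw [mul_comm]
  exact hI'.trans hle
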